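/- arXiv:2201.04713 — 2 statements merged into one kernel-verified Lean document; each statement's English description precedes it below -/
import Mathlib

section
/- For all real-valued, smooth, 2π-periodic functions f and g one has ∫₀^{2π} g(α)·f′(α)·(Λf)(α) dα = (1/2)·∫₀^{2π} ∂_α([H, g](f′))(α)·f(α) dα, where [H,g](u) = H(g·u) − g·H(u). -/
open MeasureTheory

noncomputable section

/-- The `n`-th Fourier coefficient of a `2π`-periodic function `f : ℝ → ℂ`:
`f̂(n) = (1/2π) ∫₀^{2π} f(α) e^{−inα} dα`. -/
def fc (f : ℝ → ℂ) (n : ℤ) : ℂ :=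
  (1 / (2 * Real.pi)) *
    ∫ x in (0:ℝ)..(2 * Real.pi), f x * Complex.exp (-Complex.I * (n : ℂ) * (x : ℂ))

/-- The `n`-th summand of the square of the `H^r(𝕋)` Sobolev norm of `f`. -/
def sobSummand (r : ℝ) (f : ℝ → ℂ) (n : ℤ) : ℝ :=
  (1 + (n : ℝ) ^ 2) ^ r * ‖fc f n‖ ^ 2

/-- `f ∈ H^r(𝕋)`: `f` is `2π`-periodic with finite `H^r` norm
`‖f‖_{H^r}² = ∑ₙ (1+n²)^r |f̂(n)|² < ∞`. -/
def memH (r : ℝ) (f : ℝ → ℂ) : Prop :=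
  Function.Periodic f (2 * Real.pi) ∧ Summable (sobSummand r f)

/-- The `H^r(𝕋)` Sobolev norm: `‖f‖_{H^r} = (∑ₙ (1+n²)^r |f̂(n)|²)^{1/2}`. -/
def sobNorm (r : ℝ) (f : ℝ → ℂ) : ℝ :=
  Real.sqrt (∑' n : ℤ, sobSummand r f n)

/-- Lebesgue measure restricted to one period `(0, 2π]`. -/
def pmeas : Measure ℝ := volume.restrict (Set.Ioc (0:ℝ) (2 * Real.pi))

open ComplexConjugate in
/-- Parseval's identity for continuous real periodic functions. -/
lemma parseval_aux (a b : ℝ → ℝ) (ha : Continuous a) (hap : Function.Periodic a (2 * Real.pi))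
    (hb : Continuous b) (hbp : Function.Periodic b (2 * Real.pi)) :
    ((∫ x in (0:ℝ)..(2 * Real.pi), a x * b x : ℝ) : ℂ) = (2 * Real.pi) *
      ∑' n : ℤ, conj (fc (fun x => (a x : ℂ)) n) * fc (fun x => (b x : ℂ)) n := by
  have hT : Fact (0 < 2 * Real.pi) := ⟨Real.two_pi_pos⟩
  have key : ∀ c : ℝ → ℝ, Continuous c → Function.Periodic c (2 * Real.pi) →
      ∃ C : C(AddCircle (2 * Real.pi), ℂ), (∀ x : ℝ, C (x : AddCircle (2 * Real.pi)) = (c x : ℂ)) ∧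
        ∀ n, fourierCoeff C n = fc (fun x => (c x : ℂ)) n := by
    intro c hc hcp
    have hcp' : Function.Periodic (fun x => (c x : ℂ)) (2 * Real.pi) := by
      intro x; simp only [hcp x]
    have hcont : Continuous hcp'.lift :=
      continuous_quot_lift _ (Complex.continuous_ofReal.comp hc)
    refine ⟨⟨hcp'.lift, hcont⟩, fun x => rfl, fun n => ?_⟩
    rw [fourierCoeff_eq_intervalIntegral _ n 0, fc, zero_add, Complex.real_smul]
    congr 1
    · push_cast; rfl
    · apply intervalIntegral.integral_congr
      intro x _
      simp only [ContinuousMap.coe_mk, Function.Periodic.lift_coe, smul_eq_mul, fourier_coe_apply]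
      rw [mul_comm]
      congr 2
      have : (Real.pi : ℂ) ≠ 0 := by exact_mod_cast Real.pi_ne_zero
      push_cast
      field_simp
  obtain ⟨A, hA, hA'⟩ := key a ha hap
  obtain ⟨B, hB, hB'⟩ := key b hb hbp
  have h := (fourierBasis (T := 2 * Real.pi)).tsum_inner_mul_inner
    (ContinuousMap.toLp (E := ℂ) 2 AddCircle.haarAddCircle ℂ A)
    (ContinuousMap.toLp (E := ℂ) 2 AddCircle.haarAddCircle ℂ B)
  have h1 : ∀ (n : ℤ) (C : C(AddCircle (2 * Real.pi), ℂ)),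
      inner ℂ (fourierBasis (T := 2 * Real.pi) n)
        (ContinuousMap.toLp (E := ℂ) 2 AddCircle.haarAddCircle ℂ C) = fourierCoeff C n := by
    intro n C
    rw [← HilbertBasis.repr_apply_apply, fourierBasis_repr, fourierCoeff_toLp]
  have h2 : ∀ n : ℤ, inner ℂ (ContinuousMap.toLp (E := ℂ) 2 AddCircle.haarAddCircle ℂ A)
      (fourierBasis (T := 2 * Real.pi) n) = conj (fourierCoeff A n) := by
    intro n
    rw [← h1, inner_conj_symm]
  simp only [h1, h2, hA', hB'] at h
  rw [h, ContinuousMap.inner_toLp, AddCircle.integral_haarAddCircle,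
    ← AddCircle.intervalIntegral_preimage (2 * Real.pi) 0, zero_add]
  simp only [hA, hB, Complex.conj_ofReal]
  rw [← intervalIntegral.integral_ofReal, Complex.real_smul]
  have : (Real.pi : ℂ) ≠ 0 := by exact_mod_cast Real.pi_ne_zero
  push_cast
  simp only [mul_comm]
  field_simp

lemma fc_deriv_aux (f : ℝ → ℝ) (hf : ContDiff ℝ 1 f) (hfper : Function.Periodic f (2 * Real.pi))
    (n : ℤ) : fc (fun x => ((deriv f x : ℝ) : ℂ)) n =
      Complex.I * n * fc (fun x => (f x : ℂ)) n := by
  have hd : ∀ x : ℝ, HasDerivAt (fun x : ℝ => Complex.exp (-Complex.I * (n : ℂ) * (x : ℂ)))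
      (Complex.exp (-Complex.I * (n : ℂ) * (x : ℂ)) * (-Complex.I * n)) x := by
    intro x
    have := ((Complex.ofRealCLM.hasDerivAt (x := x)).const_mul (-Complex.I * (n : ℂ))).cexp
    simpa using this
  have hfd : ∀ x : ℝ, HasDerivAt (fun x : ℝ => (f x : ℂ)) ((deriv f x : ℝ) : ℂ) x := fun x =>
    ((hf.differentiable (by norm_num)) x).hasDerivAt.ofReal_comp
  have hc : Continuous (deriv f) := hf.continuous_deriv (by norm_num)
  have h := intervalIntegral.integral_mul_deriv_eq_deriv_mul (a := 0) (b := 2 * Real.pi)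
    (fun x _ => hfd x) (fun x _ => hd x)
    (Continuous.intervalIntegrable (by fun_prop) _ _)
    (Continuous.intervalIntegrable (by fun_prop) _ _)
  have h0 : f (2 * Real.pi) = f 0 := by simpa using hfper 0
  have he : Complex.exp (-Complex.I * (n : ℂ) * ((2 * Real.pi : ℝ) : ℂ)) = 1 := by
    rw [Complex.exp_eq_one_iff]
    exact ⟨-n, by push_cast; ring⟩
  rw [h0, he] at h
  simp only [Complex.ofReal_zero, mul_zero, Complex.exp_zero, sub_self, zero_sub] at h
  simp only [← mul_assoc] at h
  rw [intervalIntegral.integral_mul_const, intervalIntegral.integral_mul_const] at h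
  simp only [neg_mul] at h
  unfold fc
  simp only [neg_mul]
  linear_combination (1 / (2 * (Real.pi : ℂ))) * h

/-- **The transport-term identity** (equation (TransportID) in Theorem 5.3 of the paper).
For real-valued, smooth, `2π`-periodic `f` and `g`, with `v = Λf` (Fourier multiplier `|n|`),
`w₁ = H(g·f')` and `w₂ = H(f')` (Fourier multiplier `−i·sgn n`), so that
`[H,g](f') = w₁ − g·w₂`, one has
`∫₀^{2π} g·f'·(Λf) dα = (1/2)·∫₀^{2π} ∂_α([H,g](f'))·f dα`. -/
theorem transport_identity
    (f g w₁ w₂ v : ℝ → ℝ)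
    (hf : ContDiff ℝ (⊤ : ℕ∞) f) (hfper : Function.Periodic f (2 * Real.pi))
    (hg : ContDiff ℝ (⊤ : ℕ∞) g) (hgper : Function.Periodic g (2 * Real.pi))
    (hw₁ : ContDiff ℝ 1 w₁) (hw₁per : Function.Periodic w₁ (2 * Real.pi))
    (hw₁c : ∀ n : ℤ, fc (fun x => (w₁ x : ℂ)) n =
      -Complex.I * (Int.sign n : ℂ) * fc (fun x => ((g x * deriv f x : ℝ) : ℂ)) n)
    (hw₂ : ContDiff ℝ 1 w₂) (hw₂per : Function.Periodic w₂ (2 * Real.pi))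
    (hw₂c : ∀ n : ℤ, fc (fun x => (w₂ x : ℂ)) n =
      -Complex.I * (Int.sign n : ℂ) * fc (fun x => ((deriv f x : ℝ) : ℂ)) n)
    (hv : Continuous v) (hvper : Function.Periodic v (2 * Real.pi))
    (hvc : ∀ n : ℤ, fc (fun x => (v x : ℂ)) n =
      ((|(n : ℝ)| : ℝ) : ℂ) * fc (fun x => (f x : ℂ)) n) :
    ∫ x in (0:ℝ)..(2 * Real.pi), g x * deriv f x * v x =
      (1 / 2) * ∫ x in (0:ℝ)..(2 * Real.pi), deriv (fun y => w₁ y - g y * w₂ y) x * f x := by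
  have hf1 : ContDiff ℝ 1 f := hf.of_le (by exact_mod_cast le_top)
  have hg1 : ContDiff ℝ 1 g := hg.of_le (by exact_mod_cast le_top)
  have hfd : Continuous (deriv f) := hf1.continuous_deriv (by norm_num)
  have hfdp : Function.Periodic (deriv f) (2 * Real.pi) := by
    intro x
    rw [← deriv_comp_add_const]
    congr 1
    exact funext hfper
  have hG : Continuous (fun x => g x * deriv f x) := hg.continuous.mul hfd
  have hGp : Function.Periodic (fun x => g x * deriv f x) (2 * Real.pi) := hgper.mul hfdp
  have hpi : (Real.pi : ℂ) ≠ 0 := by exact_mod_cast Real.pi_ne_zero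
  -- Parseval: the two coefficient sequences agree
  have e1 : ∫ x in (0:ℝ)..(2 * Real.pi), g x * deriv f x * v x =
      ∫ x in (0:ℝ)..(2 * Real.pi), g x * deriv f x * w₂ x := by
    apply Complex.ofReal_injective
    rw [parseval_aux _ _ hG hGp hv hvper, parseval_aux _ _ hG hGp hw₂.continuous hw₂per]
    congr 2
    funext n
    congr 1
    rw [hvc, hw₂c, fc_deriv_aux f hf1 hfper]
    have : ((|(n : ℝ)| : ℝ) : ℂ) = (Int.sign n : ℂ) * n := by
      rw [← Int.cast_abs, ← Int.sign_mul_self_eq_abs]; push_cast; rfl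
    rw [this]
    linear_combination ((Int.sign n : ℂ) * n * fc (fun x => (f x : ℂ)) n) * Complex.I_mul_I
  -- antisymmetry of `H`
  have e2 : ∫ x in (0:ℝ)..(2 * Real.pi), w₁ x * deriv f x =
      -∫ x in (0:ℝ)..(2 * Real.pi), g x * deriv f x * w₂ x := by
    apply Complex.ofReal_injective
    rw [Complex.ofReal_neg, parseval_aux _ _ hw₁.continuous hw₁per hfd hfdp,
      parseval_aux _ _ hG hGp hw₂.continuous hw₂per, ← mul_neg, ← tsum_neg]
    congr 2
    funext n
    rw [hw₁c, hw₂c]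
    simp only [map_mul, map_neg, Complex.conj_I, map_intCast]
    ring
  have hW : ContDiff ℝ 1 (fun y => w₁ y - g y * w₂ y) := hw₁.sub (hg1.mul hw₂)
  have e3 := intervalIntegral.integral_mul_deriv_eq_deriv_mul (a := 0) (b := 2 * Real.pi)
    (fun x _ => ((hW.differentiable (by norm_num)) x).hasDerivAt)
    (fun x _ => ((hf1.differentiable (by norm_num)) x).hasDerivAt)
    ((hW.continuous_deriv (by norm_num)).intervalIntegrable _ _)
    (hfd.intervalIntegrable _ _)
  have p1 : f (2 * Real.pi) = f 0 := by simpa using hfper 0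
  have p2 : g (2 * Real.pi) = g 0 := by simpa using hgper 0
  have p3 : w₁ (2 * Real.pi) = w₁ 0 := by simpa using hw₁per 0
  have p4 : w₂ (2 * Real.pi) = w₂ 0 := by simpa using hw₂per 0
  rw [p1, p2, p3, p4, sub_self, zero_sub] at e3
  have e4 : ∫ x in (0:ℝ)..(2 * Real.pi), (w₁ x - g x * w₂ x) * deriv f x =
      (∫ x in (0:ℝ)..(2 * Real.pi), w₁ x * deriv f x) -
      ∫ x in (0:ℝ)..(2 * Real.pi), g x * deriv f x * w₂ x := by
    rw [← intervalIntegral.integral_sub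
      (f := fun x => w₁ x * deriv f x) (g := fun x => g x * deriv f x * w₂ x)
      ((hw₁.continuous.mul hfd).intervalIntegrable _ _)
      ((hG.mul hw₂.continuous).intervalIntegrable _ _)]
    apply intervalIntegral.integral_congr
    intro x _
    ring
  rw [e1]
  linarith
end
end

section
/- Let h̃ > 0, M > 0, s ≥ 1 an integer, and s_α ≥ 1 a constant. Let θ ∈ H^s(𝕋) be real-valued with ‖θ‖_{H^s} ≤ M, and let ζ : ℝ → ℂ be continuously differentiable with ζ′ = s_α e^{iθ} and ζ(α + 2π) = ζ(α) + 2π. Let z_c ∈ ℂ satisfy Im ζ(α) − Im z_c ≥ h̃ for all α ∈ ℝ. Then the function W_cyl(ζ(·)), where W_cyl(z) := ½ − (i/2)·cot(½(z − z_c)), belongs to H^{s+1}(𝕋), and there is a constant C depending only on h̃, s, M and s_α with ‖W_cyl(ζ(·))‖_{H^{s+1}} ≤ C·(1 + ‖θ‖_{H^s}). -/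
open MeasureTheory

noncomputable section

open scoped ENNReal

/-- Continuous periodic functions. -/
def CP (f : ℝ → ℂ) : Prop := Continuous f ∧ Function.Periodic f (2 * Real.pi)

lemma CP.mul {f g : ℝ → ℂ} (hf : CP f) (hg : CP g) : CP (fun x => f x * g x) :=
  ⟨hf.1.mul hg.1, fun x => by simp only [hf.2 x, hg.2 x]⟩

lemma CP.sub {f g : ℝ → ℂ} (hf : CP f) (hg : CP g) : CP (fun x => f x - g x) :=
  ⟨hf.1.sub hg.1, fun x => by simp only [hf.2 x, hg.2 x]⟩

lemma CP.const (c : ℂ) : CP (fun _ => c) := ⟨continuous_const, fun _ => rfl⟩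

lemma CP.bounded {f : ℝ → ℂ} (hf : CP f) : ∃ B : ℝ, 0 ≤ B ∧ ∀ x, ‖f x‖ ≤ B := by
  obtain ⟨B, hB⟩ := (hf.2.compact_of_continuous (by positivity) hf.1).isBounded.exists_norm_le
  exact ⟨B, (norm_nonneg _).trans (hB (f 0) ⟨0, rfl⟩), fun x => hB _ ⟨x, rfl⟩⟩

lemma cont_kernel (n : ℤ) : Continuous fun x : ℝ => Complex.exp (-Complex.I * (n : ℂ) * (x : ℂ)) := by
  fun_prop

lemma norm_kernel (n : ℤ) (x : ℝ) : ‖Complex.exp (-Complex.I * (n : ℂ) * (x : ℂ))‖ = 1 := by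
  rw [Complex.norm_exp]; simp

lemma fc_sub {f g : ℝ → ℂ} (hf : Continuous f) (hg : Continuous g) (n : ℤ) :
    fc (fun x => f x - g x) n = fc f n - fc g n := by
  unfold fc
  rw [← mul_sub, ← intervalIntegral.integral_sub]
  · simp only [sub_mul]
  · exact (hf.mul (cont_kernel n)).intervalIntegrable _ _
  · exact (hg.mul (cont_kernel n)).intervalIntegrable _ _

lemma fc_const_mul (c : ℂ) (f : ℝ → ℂ) (n : ℤ) :
    fc (fun x => c * f x) n = c * fc f n := by
  unfold fc
  simp only [mul_assoc]
  rw [intervalIntegral.integral_const_mul]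
  ring

lemma fc_hasSum {ι : Type*} [Countable ι] {F : ι → ℝ → ℂ} {G : ℝ → ℂ} {b : ι → ℝ}
    (hF : ∀ i, Continuous (F i)) (hb : ∀ i x, ‖F i x‖ ≤ b i) (hs : Summable b)
    (hG : ∀ x, HasSum (fun i => F i x) (G x)) (n : ℤ) :
    HasSum (fun i => fc (F i) n) (fc G n) := by
  unfold fc
  apply HasSum.mul_left
  apply intervalIntegral.hasSum_integral_of_dominated_convergence (fun i _ => b i)
  · intro i
    exact ((hF i).mul (cont_kernel n)).aestronglyMeasurable
  · intro i
    refine Filter.Eventually.of_forall fun x _ => ?_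
    rw [norm_mul, norm_kernel, mul_one]
    exact hb i x
  · exact Filter.Eventually.of_forall fun x _ => hs
  · exact intervalIntegrable_const
  · exact Filter.Eventually.of_forall fun x _ => (hG x).mul_right _

instance fact_two_pi : Fact (0 < 2 * Real.pi) := ⟨by positivity⟩

lemma fc_eq_fourierCoeff {f : ℝ → ℂ} (F : AddCircle (2 * Real.pi) → ℂ) (hF : ∀ x : ℝ, F x = f x)
    (n : ℤ) : fourierCoeff F n = fc f n := by
  rw [fourierCoeff_eq_intervalIntegral F n 0]
  unfold fc
  rw [zero_add, Complex.real_smul]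
  congr 1
  · push_cast; rfl
  · apply intervalIntegral.integral_congr
    intro x _
    simp only [fourier_coe_apply, hF, smul_eq_mul]
    rw [mul_comm]
    congr 2
    have : (Real.pi : ℂ) ≠ 0 := by exact_mod_cast Real.pi_ne_zero
    push_cast
    field_simp

lemma CP.hasSum {f : ℝ → ℂ} (hf : CP f) (h : Summable (fc f)) (x : ℝ) :
    HasSum (fun n : ℤ => fc f n * Complex.exp (Complex.I * (n : ℂ) * (x : ℂ))) (f x) := by
  let F : C(AddCircle (2 * Real.pi), ℂ) := ⟨hf.2.lift, by
    exact continuous_quot_lift _ hf.1⟩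
  have hF : ∀ x : ℝ, F x = f x := fun x => hf.2.lift_coe x
  have h2 : fourierCoeff F = fc f := funext fun n => fc_eq_fourierCoeff F hF n
  have := has_pointwise_sum_fourier_series_of_summable (f := F) (by rw [h2]; exact h) x
  rw [hF, h2] at this
  convert this using 2 with n
  simp only [fourier_coe_apply, smul_eq_mul]
  congr 2
  have : (Real.pi : ℂ) ≠ 0 := by exact_mod_cast Real.pi_ne_zero
  push_cast
  field_simp

lemma fc_mul_hasSum {f g : ℝ → ℂ} (hf : CP f) (hg : CP g) (h : Summable fun n => ‖fc f n‖) (n : ℤ) :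
    HasSum (fun m : ℤ => fc f m * fc g (n - m)) (fc (fun x => f x * g x) n) := by
  obtain ⟨B, hB0, hB⟩ := hg.bounded
  have := fc_hasSum (F := fun m x => fc f m * (Complex.exp (Complex.I * (m : ℂ) * (x : ℂ)) * g x))
    (G := fun x => f x * g x) (b := fun m => ‖fc f m‖ * B) ?_ ?_ (h.mul_right B) ?_ n
  · convert this using 2 with m
    rw [fc_const_mul]
    congr 1
    unfold fc
    congr 1
    apply intervalIntegral.integral_congr
    intro x _
    simp only
    rw [mul_comm (Complex.exp _) (g x), mul_assoc (g x), ← Complex.exp_add]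
    congr 2
    push_cast
    ring
  · intro m
    have := hg.1
    fun_prop
  · intro m x
    rw [norm_mul, norm_mul]
    have : ‖Complex.exp (Complex.I * (m : ℂ) * (x : ℂ))‖ = 1 := by rw [Complex.norm_exp]; simp
    rw [this, one_mul]
    gcongr
    exact hB x
  · intro x
    simp only [← mul_assoc]
    exact (hf.hasSum h.of_norm x).mul_right _

lemma fc_deriv {f f' : ℝ → ℂ} (hf : CP f) (hf' : Continuous f') (hd : ∀ x, HasDerivAt f (f' x) x)
    (n : ℤ) : fc f' n = Complex.I * n * fc f n := by
  have h := intervalIntegral.integral_mul_deriv_eq_deriv_mul (a := 0) (b := 2 * Real.pi)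
    (u := fun x : ℝ => Complex.exp (-Complex.I * (n : ℂ) * (x : ℂ)))
    (u' := fun x : ℝ => Complex.exp (-Complex.I * (n : ℂ) * (x : ℂ)) * (-Complex.I * (n : ℂ)))
    (v := f) (v' := f') ?_ (fun x _ => hd x) ?_ (hf'.intervalIntegrable _ _)
  · unfold fc
    have e1 : f (2 * Real.pi) = f 0 := by simpa using hf.2 0
    have e2 : Complex.exp (-Complex.I * (n : ℂ) * ((2 * Real.pi : ℝ) : ℂ)) = 1 := by
      rw [Complex.exp_eq_one_iff]
      exact ⟨-n, by push_cast; ring⟩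
    have e3 : ∀ x : ℝ, Complex.exp (-Complex.I * (n : ℂ) * (x : ℂ)) * (-Complex.I * (n : ℂ)) * f x
        = (-Complex.I * n) * (f x * Complex.exp (-Complex.I * (n : ℂ) * (x : ℂ))) := fun x => by ring
    simp only [e3, e1, e2] at h
    rw [intervalIntegral.integral_const_mul] at h
    simp only [mul_comm (f' _)]
    rw [h]
    simp
    ring
  · intro x _
    have := ((hasDerivAt_id x).ofReal_comp.const_mul (-Complex.I * (n : ℂ))).cexp
    simpa using this
  · apply Continuous.intervalIntegrable
    fun_prop

/-- squared H^k norm in ENNReal -/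
def P (k : ℕ) (n : ℤ) : ℝ≥0∞ := ENNReal.ofReal ((1 + (n : ℝ) ^ 2) ^ k)

def EN (k : ℕ) (f : ℝ → ℂ) : ℝ≥0∞ := ∑' n : ℤ, P k n * ‖fc f n‖ₑ ^ 2

lemma EN_zero_le {f : ℝ → ℂ} (hf : Continuous f) {B : ℝ} (hB : ∀ x, ‖f x‖ ≤ B) :
    EN 0 f ≤ ENNReal.ofReal (B ^ 2) := by
  have hp : (0:ℝ) < 2 * Real.pi := by positivity
  have hL : MemLp f 2 (volume.restrict (Set.Ioc 0 (2 * Real.pi))) :=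
    MemLp.of_bound hf.aestronglyMeasurable B (Filter.Eventually.of_forall hB)
  have h := hasSum_sq_fourierCoeffOn hp hL
  have hc : ∀ n, fourierCoeffOn hp f n = fc f n := by
    intro n
    rw [fourierCoeffOn_eq_integral]
    unfold fc
    rw [Complex.real_smul]
    congr 1
    · push_cast; simp
    · apply intervalIntegral.integral_congr
      intro x _
      simp only [fourier_coe_apply, smul_eq_mul]
      rw [mul_comm]
      congr 2
      have : (Real.pi : ℂ) ≠ 0 := by exact_mod_cast Real.pi_ne_zero
      push_cast
      field_simp
      simp
      ring
  simp only [hc] at h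
  have e : EN 0 f = ENNReal.ofReal (∑' n : ℤ, ‖fc f n‖ ^ 2) := by
    rw [ENNReal.ofReal_tsum_of_nonneg (fun _ => by positivity) h.summable]
    unfold EN P
    congr 1; ext n
    simp [ENNReal.ofReal_pow]
  rw [e, h.tsum_eq]
  apply ENNReal.ofReal_le_ofReal
  have : ∫ x in (0:ℝ)..(2 * Real.pi), ‖f x‖ ^ 2 ≤ ∫ x in (0:ℝ)..(2 * Real.pi), B ^ 2 := by
    apply intervalIntegral.integral_mono_on hp.le
    · exact (by fun_prop : Continuous fun x => ‖f x‖ ^ 2).intervalIntegrable _ _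
    · exact intervalIntegrable_const
    · intro x _
      have := hB x
      gcongr
  rw [intervalIntegral.integral_const, smul_eq_mul] at this
  rw [smul_eq_mul, sub_zero, inv_mul_le_iff₀ hp]
  simpa using this

lemma EN_succ {f f' : ℝ → ℂ} (hf : CP f) (hf' : Continuous f') (hd : ∀ x, HasDerivAt f (f' x) x)
    (k : ℕ) : EN (k + 1) f = EN k f + EN k f' := by
  unfold EN
  rw [← ENNReal.tsum_add]
  congr 1; ext n
  rw [fc_deriv hf hf' hd, enorm_mul, enorm_mul]
  have h1 : ‖Complex.I‖ₑ = 1 := by rw [← ofReal_norm]; simp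
  have h2 : ‖(n : ℂ)‖ₑ ^ 2 = ENNReal.ofReal ((n:ℝ) ^ 2) := by
    rw [← ofReal_norm, ← ENNReal.ofReal_pow (norm_nonneg _)]; simp
  have h3 : P (k+1) n = P k n * (1 + ENNReal.ofReal ((n:ℝ) ^ 2)) := by
    unfold P
    rw [pow_succ, ENNReal.ofReal_mul (by positivity), ENNReal.ofReal_add (by positivity) (by positivity)]
    simp
  rw [h1, one_mul, mul_pow, h2, h3]
  ring

lemma P_mono {j k : ℕ} (h : j ≤ k) (n : ℤ) : P j n ≤ P k n := by
  apply ENNReal.ofReal_le_ofReal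
  exact pow_le_pow_right₀ (by nlinarith [sq_nonneg (n:ℝ)]) h

lemma EN_mono {j k : ℕ} (h : j ≤ k) (f : ℝ → ℂ) : EN j f ≤ EN k f :=
  ENNReal.tsum_le_tsum fun n => by gcongr; exact P_mono h n

lemma EN_const_mul (k : ℕ) (c : ℂ) (f : ℝ → ℂ) : EN k (fun x => c * f x) = ‖c‖ₑ ^ 2 * EN k f := by
  unfold EN
  rw [← ENNReal.tsum_mul_left]
  congr 1; ext n
  rw [fc_const_mul, enorm_mul]
  ring

lemma EN_one (k : ℕ) : EN k (fun _ => 1) ≤ 1 := by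
  induction k with
  | zero => simpa using EN_zero_le (f := fun _ => 1) continuous_const (B := 1) (by simp)
  | succ k ih =>
    rw [EN_succ (f' := fun _ => 0) (CP.const 1) continuous_const (fun x => hasDerivAt_const _ _)]
    have : EN k (fun _ => 0) = 0 := by
      simpa using EN_const_mul k 0 (fun _ => 0)
    rw [this, add_zero]
    exact ih

lemma sq_add_le (a b : ℝ≥0∞) : (a + b) ^ 2 ≤ 2 * a ^ 2 + 2 * b ^ 2 := by
  have := ENNReal.rpow_add_le_mul_rpow_add_rpow a b (p := 2) (by norm_num)
  norm_num at this
  rwa [mul_add] at this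

lemma EN_sub (k : ℕ) {f g : ℝ → ℂ} (hf : Continuous f) (hg : Continuous g) :
    EN k (fun x => f x - g x) ≤ 2 * EN k f + 2 * EN k g := by
  unfold EN
  rw [← ENNReal.tsum_mul_left, ← ENNReal.tsum_mul_left, ← ENNReal.tsum_add]
  apply ENNReal.tsum_le_tsum
  intro n
  rw [fc_sub hf hg]
  calc P k n * ‖fc f n - fc g n‖ₑ ^ 2 ≤ P k n * (‖fc f n‖ₑ + ‖fc g n‖ₑ) ^ 2 := by
        gcongr; exact enorm_sub_le
    _ ≤ P k n * (2 * ‖fc f n‖ₑ ^ 2 + 2 * ‖fc g n‖ₑ ^ 2) := by gcongr; exact sq_add_le _ _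
    _ = _ := by ring

lemma wCS {ι : Type*} (w x : ι → ℝ≥0∞) (h0 : ∀ i, w i ≠ 0) (ht : ∀ i, w i ≠ ⊤) :
    (∑' i, x i) ^ 2 ≤ (∑' i, (w i)⁻¹) * ∑' i, w i * x i ^ 2 := by
  have key : ∑' i, x i ≤ ((∑' i, (w i)⁻¹) * ∑' i, w i * x i ^ 2) ^ (1 / 2 : ℝ) := by
    rw [ENNReal.tsum_eq_iSup_sum]
    refine iSup_le fun s => ?_
    have h := ENNReal.inner_le_Lp_mul_Lq s (fun i => (w i)⁻¹ ^ (1 / 2 : ℝ))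
      (fun i => w i ^ (1 / 2 : ℝ) * x i) (p := 2) (q := 2) Real.HolderConjugate.two_two
    have e1 : ∀ i, (w i)⁻¹ ^ (1 / 2 : ℝ) * (w i ^ (1 / 2 : ℝ) * x i) = x i := fun i => by
      rw [← mul_assoc, ← ENNReal.mul_rpow_of_nonneg _ _ (by norm_num),
        ENNReal.inv_mul_cancel (h0 i) (ht i)]
      simp
    have e2 : ∀ i, ((w i)⁻¹ ^ (1 / 2 : ℝ)) ^ (2 : ℝ) = (w i)⁻¹ := fun i => by
      rw [← ENNReal.rpow_mul]; norm_num
    have e3 : ∀ i, (w i ^ (1 / 2 : ℝ) * x i) ^ (2 : ℝ) = w i * x i ^ 2 := fun i => by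
      rw [ENNReal.mul_rpow_of_nonneg _ _ (by norm_num), ← ENNReal.rpow_mul]; norm_num
    simp only [e1, e2, e3] at h
    refine h.trans ?_
    rw [← ENNReal.mul_rpow_of_nonneg _ _ (by norm_num)]
    gcongr
    · exact ENNReal.sum_le_tsum s
    · exact ENNReal.sum_le_tsum s
  calc (∑' i, x i) ^ 2 ≤ (((∑' i, (w i)⁻¹) * ∑' i, w i * x i ^ 2) ^ (1 / 2 : ℝ)) ^ 2 := by gcongr
    _ = _ := by
      rw [← ENNReal.rpow_natCast, ← ENNReal.rpow_mul]; norm_num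

lemma P_ne_zero (k : ℕ) (n : ℤ) : P k n ≠ 0 := by
  unfold P
  rw [ne_eq, ENNReal.ofReal_eq_zero, not_le]
  positivity

lemma P_ne_top (k : ℕ) (n : ℤ) : P k n ≠ ⊤ := ENNReal.ofReal_ne_top

lemma P_add (k : ℕ) (n m : ℤ) : P k n ≤ 4 ^ k * (P k m + P k (n - m)) := by
  have h4 : (4 : ℝ≥0∞) ^ k = ENNReal.ofReal (4 ^ k) := by
    rw [ENNReal.ofReal_pow (by norm_num)]; norm_num
  unfold P
  rw [← ENNReal.ofReal_add (by positivity) (by positivity), h4, ← ENNReal.ofReal_mul (by positivity)]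
  apply ENNReal.ofReal_le_ofReal
  push_cast
  generalize (n : ℝ) = a
  generalize (m : ℝ) = b
  calc (1 + a ^ 2) ^ k ≤ (2 * ((1 + b ^ 2) + (1 + (a - b) ^ 2))) ^ k := by
        gcongr
        nlinarith [sq_nonneg (a - 2 * b)]
    _ = 2 ^ k * ((1 + b ^ 2) + (1 + (a - b) ^ 2)) ^ k := by rw [mul_pow]
    _ ≤ 2 ^ k * (2 ^ (k - 1) * ((1 + b ^ 2) ^ k + (1 + (a - b) ^ 2) ^ k)) := by
        gcongr
        exact add_pow_le (by positivity) (by positivity) k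
    _ ≤ 2 ^ k * (2 ^ k * ((1 + b ^ 2) ^ k + (1 + (a - b) ^ 2) ^ k)) := by
        gcongr
        · norm_num
        · omega
    _ = _ := by rw [← mul_assoc, ← mul_pow]; norm_num

def SS (k : ℕ) : ℝ≥0∞ := ∑' n : ℤ, (P k n)⁻¹

lemma SS_ne_top {k : ℕ} (hk : 1 ≤ k) : SS k ≠ ⊤ := by
  have h1 : SS k ≤ ∑' n : ℤ, ENNReal.ofReal (1 / (n : ℝ) ^ 2 + if n = 0 then 1 else 0) := by
    apply ENNReal.tsum_le_tsum
    intro n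
    refine (ENNReal.inv_le_inv.2 (P_mono hk n)).trans ?_
    unfold P
    rw [← ENNReal.ofReal_inv_of_pos (by positivity)]
    apply ENNReal.ofReal_le_ofReal
    by_cases hn : n = 0
    · simp [hn]
    · have : (0 : ℝ) < (n : ℝ) ^ 2 := by positivity
      simp only [hn, if_false, add_zero, pow_one, one_div]
      gcongr
      linarith
  refine ne_top_of_le_ne_top ?_ h1
  have hs : Summable fun n : ℤ => (1 / (n : ℝ) ^ 2 + if n = 0 then 1 else 0) :=
    (Real.summable_one_div_int_pow.2 (by norm_num)).add (hasSum_ite_eq (0 : ℤ) (1 : ℝ)).summable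
  rw [← ENNReal.ofReal_tsum_of_nonneg _ hs]
  · exact ENNReal.ofReal_ne_top
  · intro n
    split_ifs <;> positivity

lemma summable_fc {k : ℕ} (hk : 1 ≤ k) {f : ℝ → ℂ} (h : EN k f ≠ ⊤) :
    Summable fun n => ‖fc f n‖ := by
  have h1 := wCS (P k) (fun n => ‖fc f n‖ₑ) (P_ne_zero k) (P_ne_top k)
  have h2 : (∑' n, ‖fc f n‖ₑ) ≠ ⊤ := by
    intro ht
    rw [ht] at h1
    have : SS k * EN k f ≠ ⊤ := ENNReal.mul_ne_top (SS_ne_top hk) h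
    apply this
    have := top_le_iff.1 h1
    simpa [SS, EN] using this
  have h3 := ENNReal.tsum_coe_ne_top_iff_summable.1 h2
  exact NNReal.summable_coe.2 h3

lemma EN_mul {k : ℕ} (hk : 1 ≤ k) {f g : ℝ → ℂ} (hf : CP f) (hg : CP g) (h : EN k f ≠ ⊤) :
    EN k (fun x => f x * g x) ≤ (4 ^ k * (2 * SS k)) * (EN k f * EN k g) := by
  have hsub : ∀ (n : ℤ) (u : ℤ → ℝ≥0∞), ∑' m, u (n - m) = ∑' m, u m := fun n u =>
    (Equiv.subLeft n).tsum_eq u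
  have hsub' : ∀ (m : ℤ) (u : ℤ → ℝ≥0∞), ∑' n, u (n - m) = ∑' n, u n := fun m u =>
    (Equiv.subRight m).tsum_eq u
  have step : ∀ n : ℤ, P k n * ‖fc (fun x => f x * g x) n‖ₑ ^ 2 ≤
      (4 ^ k * (2 * SS k)) *
        ∑' m, (P k m * ‖fc f m‖ₑ ^ 2) * (P k (n - m) * ‖fc g (n - m)‖ₑ ^ 2) := by
    intro n
    have h1 : ‖fc (fun x => f x * g x) n‖ₑ ≤ ∑' m, ‖fc f m‖ₑ * ‖fc g (n - m)‖ₑ := by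
      rw [← (fc_mul_hasSum hf hg (summable_fc hk h) n).tsum_eq]
      refine enorm_tsum_le_tsum_enorm.trans_eq ?_
      simp only [enorm_mul]
    have h2 := wCS (fun m => P k m * P k (n - m)) (fun m => ‖fc f m‖ₑ * ‖fc g (n - m)‖ₑ)
      (fun m => mul_ne_zero (P_ne_zero _ _) (P_ne_zero _ _))
      (fun m => ENNReal.mul_ne_top (P_ne_top _ _) (P_ne_top _ _))
    have h3 : P k n * ∑' m, (P k m * P k (n - m))⁻¹ ≤ 4 ^ k * (2 * SS k) := by
      have e : (2 * SS k) = ∑' m, ((P k (n - m))⁻¹ + (P k m)⁻¹) := by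
        rw [ENNReal.tsum_add, hsub n (fun m => (P k m)⁻¹), two_mul]; rfl
      rw [e, ← ENNReal.tsum_mul_left, ← ENNReal.tsum_mul_left]
      apply ENNReal.tsum_le_tsum
      intro m
      calc P k n * (P k m * P k (n - m))⁻¹
          ≤ (4 ^ k * (P k m + P k (n - m))) * (P k m * P k (n - m))⁻¹ := by
            gcongr; exact P_add k n m
        _ = 4 ^ k * ((P k m * (P k m)⁻¹) * (P k (n - m))⁻¹
              + (P k (n - m) * (P k (n - m))⁻¹) * (P k m)⁻¹) := by
            rw [ENNReal.mul_inv (Or.inl (P_ne_zero _ _)) (Or.inl (P_ne_top _ _))]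
            ring
        _ = _ := by
            rw [ENNReal.mul_inv_cancel (P_ne_zero _ _) (P_ne_top _ _),
              ENNReal.mul_inv_cancel (P_ne_zero _ _) (P_ne_top _ _), one_mul, one_mul]
    calc P k n * ‖fc (fun x => f x * g x) n‖ₑ ^ 2
        ≤ P k n * ((∑' m, (P k m * P k (n - m))⁻¹) *
          ∑' m, P k m * P k (n - m) * (‖fc f m‖ₑ * ‖fc g (n - m)‖ₑ) ^ 2) := by
          gcongr
          exact (pow_le_pow_left' h1 2).trans h2
      _ = (P k n * ∑' m, (P k m * P k (n - m))⁻¹) *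
          ∑' m, P k m * P k (n - m) * (‖fc f m‖ₑ * ‖fc g (n - m)‖ₑ) ^ 2 := by rw [mul_assoc]
      _ ≤ (4 ^ k * (2 * SS k)) *
          ∑' m, P k m * P k (n - m) * (‖fc f m‖ₑ * ‖fc g (n - m)‖ₑ) ^ 2 := by gcongr
      _ = _ := by
          congr 2; ext m; ring
  calc EN k (fun x => f x * g x) ≤ ∑' n : ℤ, (4 ^ k * (2 * SS k)) *
        ∑' m, (P k m * ‖fc f m‖ₑ ^ 2) * (P k (n - m) * ‖fc g (n - m)‖ₑ ^ 2) :=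
        ENNReal.tsum_le_tsum step
    _ = (4 ^ k * (2 * SS k)) * ∑' m : ℤ, ∑' n : ℤ,
        (P k m * ‖fc f m‖ₑ ^ 2) * (P k (n - m) * ‖fc g (n - m)‖ₑ ^ 2) := by
        rw [ENNReal.tsum_mul_left, ENNReal.tsum_comm]
    _ = _ := by
        congr 1
        simp only [ENNReal.tsum_mul_left]
        simp only [fun m => hsub' m (fun n => P k n * ‖fc g n‖ₑ ^ 2)]
        rw [ENNReal.tsum_mul_right]
        rfl

def KK (k : ℕ) : ℝ≥0∞ := 4 ^ k * (2 * SS k)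

lemma KK_ne_top {k : ℕ} (hk : 1 ≤ k) : KK k ≠ ⊤ := by
  unfold KK
  have := SS_ne_top hk
  exact ENNReal.mul_ne_top (by simp) (ENNReal.mul_ne_top (by simp) this)

lemma CP.pow {f : ℝ → ℂ} (hf : CP f) (j : ℕ) : CP (fun x => f x ^ j) :=
  ⟨hf.1.pow j, fun x => by simp only [hf.2 x]⟩

lemma EN_pow {k : ℕ} (hk : 1 ≤ k) {f : ℝ → ℂ} (hf : CP f) {D : ℝ≥0∞} (hD : D ≠ ⊤)
    (h : EN k f ≤ D) (j : ℕ) : EN k (fun x => f x ^ j) ≤ (KK k * D) ^ j := by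
  induction j with
  | zero => simpa using EN_one k
  | succ j ih =>
    have : (fun x => f x ^ (j + 1)) = fun x => f x * f x ^ j := by ext x; ring
    rw [this]
    refine (EN_mul hk hf (hf.pow j) (ne_top_of_le_ne_top hD h)).trans ?_
    calc KK k * (EN k f * EN k fun x => f x ^ j) ≤ KK k * (D * (KK k * D) ^ j) := by gcongr
      _ = _ := by ring

lemma EN_exp {k : ℕ} (hk : 1 ≤ k) {D : ℝ≥0∞} (hD : D ≠ ⊤) :
    ∃ C : ℝ≥0∞, C ≠ ⊤ ∧ ∀ f : ℝ → ℂ, CP f → EN k f ≤ D → EN k (fun x => Complex.exp (f x)) ≤ C := by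
  have hr : KK k * D ≠ ⊤ := ENNReal.mul_ne_top (KK_ne_top hk) hD
  set r := (KK k * D).toReal with hrdef
  have hr2 : KK k * D = ENNReal.ofReal r := (ENNReal.ofReal_toReal hr).symm
  have hr0 : 0 ≤ r := ENNReal.toReal_nonneg
  refine ⟨(∑' j : ℕ, ((2:ℝ≥0∞) ^ j)⁻¹) * ENNReal.ofReal (∑' j : ℕ, (2 * r) ^ j / (j.factorial : ℝ)),
    ENNReal.mul_ne_top ?_ ENNReal.ofReal_ne_top, ?_⟩
  · simp only [ENNReal.inv_pow]
    rw [ENNReal.tsum_geometric]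
    simp
  intro f hf hfD
  obtain ⟨B, hB0, hB⟩ := hf.bounded
  let F : ℕ → ℝ → ℂ := fun j x => (1 / (j.factorial : ℂ)) * f x ^ j
  have hF : ∀ j, EN k (F j) ≤ ENNReal.ofReal (r ^ j / (j.factorial : ℝ)) := by
    intro j
    rw [EN_const_mul]
    calc ‖1 / (j.factorial : ℂ)‖ₑ ^ 2 * EN k (fun x => f x ^ j)
        ≤ ENNReal.ofReal (1 / (j.factorial : ℝ)) * ENNReal.ofReal (r ^ j) := by
          gcongr
          · rw [← ofReal_norm, ← ENNReal.ofReal_pow (norm_nonneg _)]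
            apply ENNReal.ofReal_le_ofReal
            have h1 : (1 : ℝ) ≤ j.factorial := by exact_mod_cast Nat.succ_le_of_lt j.factorial_pos
            have h2 : 1 / (j.factorial : ℝ) ≤ 1 := by
              rw [div_le_one (by linarith)]; exact h1
            have h3 : 0 ≤ 1 / (j.factorial : ℝ) := by positivity
            have h4 : ‖1 / (j.factorial : ℂ)‖ = 1 / (j.factorial : ℝ) := by simp
            rw [h4]
            nlinarith
          · refine (EN_pow hk hf hD hfD j).trans ?_
            rw [hr2, ENNReal.ofReal_pow hr0]
      _ = _ := by
          rw [← ENNReal.ofReal_mul (by positivity)]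
          congr 1; ring
  have hsum : ∀ n, HasSum (fun j => fc (F j) n) (fc (fun x => Complex.exp (f x)) n) := by
    intro n
    refine fc_hasSum (F := F) (G := fun x => Complex.exp (f x)) (b := fun j => B ^ j / (j.factorial : ℝ)) ?_ ?_
      (Real.summable_pow_div_factorial B) ?_ n
    · intro j
      exact continuous_const.mul (hf.1.pow j)
    · intro j x
      simp only [F, norm_mul, norm_pow, norm_div, norm_one, Complex.norm_natCast]
      rw [one_div_mul_eq_div]
      have := hB x
      gcongr
    · intro x
      have := NormedSpace.expSeries_div_hasSum_exp (𝔸 := ℂ) (f x)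
      rw [← Complex.exp_eq_exp_ℂ] at this
      have e : (fun j => F j x) = fun j : ℕ => f x ^ j / (j.factorial : ℂ) := by
        ext j
        change 1 / (j.factorial : ℂ) * f x ^ j = _
        ring
      rw [e]
      exact this
  have step : ∀ n : ℤ, P k n * ‖fc (fun x => Complex.exp (f x)) n‖ₑ ^ 2 ≤
      (∑' j : ℕ, ((2:ℝ≥0∞) ^ j)⁻¹) * ∑' j, 2 ^ j * (P k n * ‖fc (F j) n‖ₑ ^ 2) := by
    intro n
    have h1 : ‖fc (fun x => Complex.exp (f x)) n‖ₑ ≤ ∑' j, ‖fc (F j) n‖ₑ := by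
      rw [← (hsum n).tsum_eq]
      exact enorm_tsum_le_tsum_enorm
    have h2 := wCS (fun j : ℕ => (2:ℝ≥0∞) ^ j) (fun j => ‖fc (F j) n‖ₑ) (by simp) (by simp)
    calc P k n * ‖fc (fun x => Complex.exp (f x)) n‖ₑ ^ 2
        ≤ P k n * ((∑' j : ℕ, ((2:ℝ≥0∞) ^ j)⁻¹) * ∑' j, 2 ^ j * ‖fc (F j) n‖ₑ ^ 2) := by
          gcongr
          exact (pow_le_pow_left' h1 2).trans h2
      _ = (∑' j : ℕ, ((2:ℝ≥0∞) ^ j)⁻¹) * (P k n * ∑' j, 2 ^ j * ‖fc (F j) n‖ₑ ^ 2) := by ring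
      _ = _ := by
          rw [← ENNReal.tsum_mul_left]
          congr 2; ext j; ring
  calc EN k (fun x => Complex.exp (f x)) ≤ ∑' n : ℤ, (∑' j : ℕ, ((2:ℝ≥0∞) ^ j)⁻¹) *
          ∑' j, 2 ^ j * (P k n * ‖fc (F j) n‖ₑ ^ 2) := ENNReal.tsum_le_tsum step
    _ = (∑' j : ℕ, ((2:ℝ≥0∞) ^ j)⁻¹) * ∑' j, 2 ^ j * EN k (F j) := by
        rw [ENNReal.tsum_mul_left, ENNReal.tsum_comm]
        simp only [ENNReal.tsum_mul_left]
        rfl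
    _ ≤ (∑' j : ℕ, ((2:ℝ≥0∞) ^ j)⁻¹) *
          ∑' j : ℕ, ENNReal.ofReal ((2 * r) ^ j / (j.factorial : ℝ)) := by
        gcongr with j
        calc 2 ^ j * EN k (F j) ≤ 2 ^ j * ENNReal.ofReal (r ^ j / (j.factorial : ℝ)) := by
              gcongr; exact hF j
          _ = _ := by
              have : (2 : ℝ≥0∞) ^ j = ENNReal.ofReal (2 ^ j) := by
                rw [ENNReal.ofReal_pow (by norm_num)]; norm_num
              rw [this, ← ENNReal.ofReal_mul (by positivity), mul_pow, mul_div_assoc]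
    _ = _ := by
        rw [ENNReal.ofReal_tsum_of_nonneg (fun j => by positivity)
          (Real.summable_pow_div_factorial (2 * r))]

lemma boot (s : ℕ) (CE : ℝ≥0∞) (hCE : CE ≠ ⊤) (A : ℝ) (c : ℂ) (j : ℕ) (hj : j ≤ s) :
    ∃ C : ℝ≥0∞, C ≠ ⊤ ∧ ∀ E W : ℝ → ℂ, CP E → CP W → EN s E ≤ CE → (∀ x, ‖W x‖ ≤ A) →
      (∀ x, ‖E x‖ ≤ 1) → (∀ x, HasDerivAt W (c * (E x * (W x * (1 - W x)))) x) →
      EN (j + 1) W ≤ C := by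
  induction j with
  | zero =>
    refine ⟨ENNReal.ofReal (A ^ 2) + ENNReal.ofReal ((‖c‖ * (1 * (A * (1 + A)))) ^ 2), by simp, ?_⟩
    intro E W hE hW hEC hWA hE1 hd
    have hV : Continuous fun x => c * (E x * (W x * (1 - W x))) := by
      have := hE.1
      have := hW.1
      fun_prop
    rw [EN_succ hW hV hd]
    refine add_le_add (EN_zero_le hW.1 hWA) (EN_zero_le hV fun x => ?_)
    rw [norm_mul, norm_mul, norm_mul]
    have h1 : ‖1 - W x‖ ≤ 1 + A := (norm_sub_le _ _).trans (by simpa using hWA x)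
    have hA : 0 ≤ A := (norm_nonneg _).trans (hWA x)
    gcongr
    · exact hE1 x
    · exact hWA x
  | succ j ih =>
    obtain ⟨C, hC, ih⟩ := ih (by omega)
    have hk : 1 ≤ j + 1 := by omega
    have hK := KK_ne_top hk
    refine ⟨C + ‖c‖ₑ ^ 2 * (KK (j + 1) * (CE * (KK (j + 1) * (C * (2 * 1 + 2 * C))))), ?_, ?_⟩
    · refine ENNReal.add_ne_top.2 ⟨hC, ENNReal.mul_ne_top (by simp) (ENNReal.mul_ne_top hK
        (ENNReal.mul_ne_top hCE (ENNReal.mul_ne_top hK (ENNReal.mul_ne_top hC ?_))))⟩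
      exact ENNReal.add_ne_top.2 ⟨by simp, ENNReal.mul_ne_top (by simp) hC⟩
    intro E W hE hW hEC hWA hE1 hd
    have hV : Continuous fun x => c * (E x * (W x * (1 - W x))) := by
      have := hE.1
      have := hW.1
      fun_prop
    have hCW := ih E W hE hW hEC hWA hE1 hd
    rw [EN_succ hW hV hd]
    refine add_le_add hCW ?_
    rw [EN_const_mul]
    have h1W : CP fun x => 1 - W x := (CP.const 1).sub hW
    have hEk : EN (j + 1) E ≤ CE := (EN_mono hj E).trans hEC
    gcongr
    refine (EN_mul hk hE (hW.mul h1W) (ne_top_of_le_ne_top hCE hEk)).trans ?_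
    change KK (j + 1) * _ ≤ _
    gcongr
    refine (EN_mul hk hW h1W (ne_top_of_le_ne_top hC hCW)).trans ?_
    change KK (j + 1) * _ ≤ _
    gcongr
    refine (EN_sub _ continuous_const hW.1).trans ?_
    gcongr
    exact EN_one _

lemma EN_eq (k : ℕ) (f : ℝ → ℂ) : EN k f = ∑' n, ENNReal.ofReal (sobSummand k f n) := by
  unfold EN P sobSummand
  congr 1; ext n
  rw [ENNReal.ofReal_mul (by positivity), Real.rpow_natCast, ENNReal.ofReal_pow (norm_nonneg _),
    ofReal_norm]

lemma sobSummand_nonneg (r : ℝ) (f : ℝ → ℂ) (n : ℤ) : 0 ≤ sobSummand r f n := by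
  unfold sobSummand; positivity

lemma EN_le_of_sobNorm {k : ℕ} {f : ℝ → ℂ} (h : memH k f) {M : ℝ} (hM : sobNorm k f ≤ M) :
    EN k f ≤ ENNReal.ofReal (M ^ 2) := by
  rw [EN_eq, ← ENNReal.ofReal_tsum_of_nonneg (sobSummand_nonneg _ _) h.2]
  apply ENNReal.ofReal_le_ofReal
  exact (Real.sqrt_le_left ((Real.sqrt_nonneg _).trans hM)).1 hM

lemma of_EN_le {k : ℕ} {f : ℝ → ℂ} {C : ℝ≥0∞} (hC : C ≠ ⊤) (h : EN k f ≤ C) :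
    Summable (sobSummand k f) ∧ sobNorm k f ≤ Real.sqrt C.toReal := by
  have h1 : ∑' n, ENNReal.ofReal (sobSummand k f n) ≠ ⊤ := by
    rw [← EN_eq]; exact ne_top_of_le_ne_top hC h
  have hs : Summable (sobSummand k f) := by
    have := ENNReal.summable_toReal h1
    simpa only [ENNReal.toReal_ofReal (sobSummand_nonneg _ _ _)] using this
  refine ⟨hs, ?_⟩
  apply Real.sqrt_le_sqrt
  rw [EN_eq, ← ENNReal.ofReal_tsum_of_nonneg (sobSummand_nonneg _ _) hs] at h
  exact (ENNReal.ofReal_le_iff_le_toReal hC).1 h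

lemma W_formula (w : ℂ) (hq : Complex.exp (Complex.I * w) ≠ 1) :
    (1 / 2 : ℂ) - Complex.I / 2 * Complex.cot (w / 2) =
      Complex.exp (Complex.I * w) / (Complex.exp (Complex.I * w) - 1) := by
  rw [Complex.cot_eq_exp_ratio]
  have e : 2 * Complex.I * (w / 2) = Complex.I * w := by ring
  rw [e]
  generalize Complex.exp (Complex.I * w) = q at *
  have h1 : q - 1 ≠ 0 := sub_ne_zero.2 hq
  have h2 : 1 - q ≠ 0 := sub_ne_zero.2 (Ne.symm hq)
  have h3 := Complex.I_ne_zero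
  field_simp
  ring

/-- **Sobolev bound for the background-current velocity `∇φ_cyl(ζ)`** (part of Lemma 5.4 of
the paper).  Let `h̃ > 0`, `M > 0`, `s ≥ 1` an integer, and `s_α ≥ 1` a constant.  There is a
constant `C = C(h̃, s, M, s_α)` such that for every real-valued `θ ∈ H^s(𝕋)` with
`‖θ‖_{H^s} ≤ M`, every `ζ` with `ζ′ = s_α e^{iθ}` and `ζ(α+2π) = ζ(α)+2π`, and every
`z_c ∈ ℂ` with `Im ζ(α) − Im z_c ≥ h̃`, the function `W_cyl(ζ(·))`, where
`W_cyl(z) = ½ − (i/2)·cot(½(z − z_c))` is the complexified gradient of `φ_cyl`, belongs to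
`H^{s+1}(𝕋)` with `‖W_cyl(ζ(·))‖_{H^{s+1}} ≤ C·(1 + ‖θ‖_{H^s})`. -/
theorem background_current_bound
    (ht : ℝ) (hht : 0 < ht) (M : ℝ) (hM : 0 < M) (s : ℕ) (hs : 1 ≤ s)
    (sα : ℝ) (hsα : 1 ≤ sα) :
    ∃ C > (0 : ℝ), ∀ (θ : ℝ → ℝ) (ζ : ℝ → ℂ) (zc : ℂ),
      Continuous θ →
      memH s (fun x => (θ x : ℂ)) →
      sobNorm s (fun x => (θ x : ℂ)) ≤ M →
      (∀ α : ℝ, HasDerivAt ζ ((sα : ℂ) * Complex.exp (Complex.I * (θ α : ℂ))) α) →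
      (∀ α : ℝ, ζ (α + 2 * Real.pi) = ζ α + (2 * Real.pi : ℝ)) →
      (∀ α : ℝ, ht ≤ (ζ α).im - zc.im) →
      memH (s + 1)
          (fun α => (1 / 2 : ℂ) - Complex.I / 2 * Complex.cot ((ζ α - zc) / 2)) ∧
        sobNorm (s + 1)
            (fun α => (1 / 2 : ℂ) - Complex.I / 2 * Complex.cot ((ζ α - zc) / 2)) ≤
          C * (1 + sobNorm s (fun x => (θ x : ℂ))) := by
  obtain ⟨CE, hCE, hexp⟩ := EN_exp hs (D := ‖Complex.I‖ₑ ^ 2 * ENNReal.ofReal (M ^ 2))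
    (ENNReal.mul_ne_top (by simp) ENNReal.ofReal_ne_top)
  set ρ : ℝ := Real.exp (-ht) with hρ
  have hρ1 : ρ < 1 := by rw [hρ, Real.exp_lt_one_iff]; linarith
  obtain ⟨C, hC, hboot⟩ := boot s CE hCE (ρ / (1 - ρ)) (Complex.I * sα) s le_rfl
  refine ⟨Real.sqrt C.toReal + 1, by positivity, ?_⟩
  intro θ ζ zc hθ hmem hnorm hζ hper him
  set W : ℝ → ℂ := fun α => (1 / 2 : ℂ) - Complex.I / 2 * Complex.cot ((ζ α - zc) / 2) with hW
  set q : ℝ → ℂ := fun α => Complex.exp (Complex.I * (ζ α - zc)) with hq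
  have hqn : ∀ α, ‖q α‖ ≤ ρ := by
    intro α
    rw [hq, hρ, Complex.norm_exp]
    apply Real.exp_le_exp.2
    have := him α
    simp
    linarith
  have hq1 : ∀ α, q α ≠ 1 := by
    intro α h
    have := hqn α
    rw [h, norm_one] at this
    linarith
  have hq1' : ∀ α, q α - 1 ≠ 0 := fun α => sub_ne_zero.2 (hq1 α)
  have hWq : ∀ α, W α = q α / (q α - 1) := fun α => W_formula _ (hq1 α)
  have hqp : ∀ α, q (α + 2 * Real.pi) = q α := by
    intro α
    simp only [hq, hper]
    rw [Complex.exp_eq_exp_iff_exists_int]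
    exact ⟨1, by push_cast; ring⟩
  have hWp : Function.Periodic W (2 * Real.pi) := fun α => by rw [hWq, hWq, hqp]
  set E : ℝ → ℂ := fun α => Complex.exp (Complex.I * (θ α : ℂ)) with hE
  have hqd : ∀ α, HasDerivAt q (q α * (Complex.I * (sα * E α))) α := fun α =>
    (((hζ α).sub_const zc).const_mul Complex.I).cexp
  have hWd : ∀ α, HasDerivAt W (Complex.I * sα * (E α * (W α * (1 - W α)))) α := by
    intro α
    have h1 := (hqd α).div ((hqd α).sub_const 1) (hq1' α)
    have h2 : W = q / (fun α => q α - 1) := funext hWq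
    rw [← h2] at h1
    refine h1.congr_deriv ?_
    rw [hWq]
    have := hq1' α
    field_simp
  have hWc : CP W := ⟨continuous_iff_continuousAt.2 fun α => (hWd α).continuousAt, hWp⟩
  have hθp : CP fun x => Complex.I * (θ x : ℂ) :=
    ⟨by fun_prop, fun x => by
      have := hmem.1 x
      simp only at this
      simp only [this]⟩
  have hEc : CP E := ⟨by fun_prop, fun x => by
      have := hθp.2 x
      simp only at this
      simp only [hE, this]⟩
  have hWA : ∀ x, ‖W x‖ ≤ ρ / (1 - ρ) := by
    intro x
    rw [hWq, norm_div]
    have h1 : 1 - ρ ≤ ‖q x - 1‖ := by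
      have := norm_sub_norm_le (1 : ℂ) (q x)
      rw [norm_one, norm_sub_rev] at this
      linarith [hqn x]
    have : 0 < 1 - ρ := by linarith
    have h0 : 0 ≤ ρ := (norm_nonneg _).trans (hqn x)
    gcongr
    exact hqn x
  have hEs : EN s E ≤ CE := by
    apply hexp _ hθp
    rw [EN_const_mul]
    gcongr
    exact EN_le_of_sobNorm hmem hnorm
  have hE1 : ∀ x, ‖E x‖ ≤ 1 := by
    intro x
    rw [hE, Complex.norm_exp]
    simp
  have hfin := of_EN_le hC (hboot E W hEc hWc hEs hWA hE1 hWd)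
  have hcast : ((s + 1 : ℕ) : ℝ) = (s : ℝ) + 1 := by push_cast; ring
  rw [hcast] at hfin
  refine ⟨⟨hWp, hfin.1⟩, hfin.2.trans ?_⟩
  have h0 : 0 ≤ sobNorm s (fun x => (θ x : ℂ)) := Real.sqrt_nonneg _
  nlinarith [Real.sqrt_nonneg C.toReal]
end
end
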